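/- arXiv:2409.18187 — 2 statements merged into one kernel-verified Lean document; each statement's English description precedes it below -/
import Mathlib

section
/- Let {G_n}_{n≥0} be a crossed simplicial group with canonical parity λ₀: G₀ → C₂. Then the group homomorphisms L_n: G_n → G₀≀Σ_{n+1}, L_n(g) = (φ₀*(g),…,φ_n*(g); θ_g), constitute a morphism of crossed simplicial groups from ΔG to the twisted symmetric crossed simplicial group Δλ₀≀Σ; explicitly, for all n ≥ 0, g ∈ G_n and 0 ≤ i ≤ n: (i) θ_{L_n(g)} = θ_g, where θ_{L_n(g)} is computed in Δλ₀≀Σ; (ii) L_{n−1}(δ_i*(g)) = δ_i*(L_n(g)) for n ≥ 1; and (iii) L_{n+1}(σ_i*(g)) = σ_i*(L_n(g)), where on the right-hand sides δ_i* and σ_i* are the operations of Δλ₀≀Σ. Consequently the canonical functor λ: ΔG → ΔH to the hyperoctahedral crossed simplicial group factors through Δλ₀≀Σ. -/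
/-!
STATEMENT 7: the maps `L_n : G_n → G₀ ≀ Σ_{n+1}` constitute a morphism of crossed
simplicial groups `ΔG → Δλ₀≀Σ`, where `λ₀` is the canonical parity: (i) `θ_{L_n(g)} = θ_g`,
(ii) `L_{n-1}(δ_i*(g)) = δ_i*(L_n(g))`, (iii) `L_{n+1}(σ_i*(g)) = σ_i*(L_n(g))`;
consequently the canonical functor `λ : ΔG → ΔH` factors through `Δλ₀≀Σ`.
-/

open CategoryTheory SimplexCategory

/-- A crossed simplicial group: a sequence of groups `{G_n}` together with operations
`ψ*(g) ∈ G_m` and `g*(ψ) ∈ Δ([m],[n])` for every `ψ ∈ Δ([m],[n])` and `g ∈ G_n`,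
satisfying the six crossed-simplicial-group identities
(1.h), (2.h), (3.h), (1.v), (2.v), (3.v). -/
structure CSG (G : ℕ → Type) [∀ n, Group (G n)] : Type where
  hact : ∀ {m n : ℕ}, (mk m ⟶ mk n) → G n → G m
  vact : ∀ {m n : ℕ}, G n → (mk m ⟶ mk n) → (mk m ⟶ mk n)
  id1h : ∀ {k m n : ℕ} (ψ : mk m ⟶ mk n) (χ : mk k ⟶ mk m) (g : G n),
    hact (χ ≫ ψ) g = hact χ (hact ψ g)
  id3h₁ : ∀ {n : ℕ} (g : G n), hact (𝟙 (mk n)) g = g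
  id3h₂ : ∀ {m n : ℕ} (ψ : mk m ⟶ mk n), hact ψ (1 : G n) = 1
  id1v : ∀ {m n : ℕ} (g h : G n) (ψ : mk m ⟶ mk n), vact (g * h) ψ = vact h (vact g ψ)
  id3v₁ : ∀ {m n : ℕ} (ψ : mk m ⟶ mk n), vact (1 : G n) ψ = ψ
  id3v₂ : ∀ {n : ℕ} (g : G n), vact g (𝟙 (mk n)) = 𝟙 (mk n)
  id2h : ∀ {k m n : ℕ} (ψ : mk m ⟶ mk n) (χ : mk k ⟶ mk m) (g : G n),
    vact g (χ ≫ ψ) = vact (hact ψ g) χ ≫ vact g ψ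
  id2v : ∀ {m n : ℕ} (ψ : mk m ⟶ mk n) (g h : G n),
    hact ψ (g * h) = hact ψ g * hact (vact g ψ) h

/-- The crossed simplicial structure of the symmetric crossed simplicial group `Δ𝐒`:
for `γ ∈ Σ_{n+1}` and `ψ ∈ Δ([m],[n])`, the pair `(γ*(ψ), ψ*(γ))` is (uniquely) determined
by the requirements `γ ∘ (γ*(ψ)) = ψ ∘ (ψ*(γ))` as maps of sets and that `ψ*(γ)` maps each
fiber of `γ*(ψ)` order-preservingly onto the corresponding fiber of `ψ`. -/
structure SymCSG : Type where
  vact : ∀ {m n : ℕ}, Equiv.Perm (Fin (n + 1)) → (mk m ⟶ mk n) → (mk m ⟶ mk n)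
  hact : ∀ {m n : ℕ}, (mk m ⟶ mk n) → Equiv.Perm (Fin (n + 1)) → Equiv.Perm (Fin (m + 1))
  compat : ∀ {m n : ℕ} (γ : Equiv.Perm (Fin (n + 1))) (ψ : mk m ⟶ mk n) (x : Fin (m + 1)),
    γ ((vact γ ψ).toOrderHom x) = ψ.toOrderHom (hact ψ γ x)
  fiber_mono : ∀ {m n : ℕ} (γ : Equiv.Perm (Fin (n + 1))) (ψ : mk m ⟶ mk n)
    (x y : Fin (m + 1)), (vact γ ψ).toOrderHom x = (vact γ ψ).toOrderHom y → x ≤ y →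
      hact ψ γ x ≤ hact ψ γ y

/-- The underlying set of the wreath product `G ≀ Σ_{n+1}`. -/
abbrev W (G : Type) (n : ℕ) : Type := (Fin (n + 1) → G) × Equiv.Perm (Fin (n + 1))

/-- The wreath product multiplication. -/
def wmul {G : Type} [Group G] {n : ℕ} (x y : W G n) : W G n :=
  (fun i => x.1 i * y.1 (x.2⁻¹ i), x.2 * y.2)

/-- The operation `δ_i*` of the twisted symmetric crossed simplicial group on a general
element `(g_0,…,g_n;γ)`:  `δ_i*(g;γ) = (g_0,…,g_{i-1},g_{i+1},…,g_n; δ_i*(γ))`, with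
`δ_i*(γ)` computed in `Δ𝐒`. -/
def tdel {G : Type} [Group G] (S : SymCSG) {n : ℕ} (x : W G (n + 1)) (i : Fin (n + 2)) :
    W G n :=
  ((fun j => x.1 ((SimplexCategory.δ i).toOrderHom j)), S.hact (SimplexCategory.δ i) x.2)

/-- The operation `σ_i*` of the twisted symmetric crossed simplicial group (for the
parity `lam`) on a general element `(g_0,…,g_n;γ)`:
`σ_i*(g;γ) = (g_0,…,g_i,g_i,…,g_n; τ · σ_i*(γ))`, with `σ_i*(γ)` computed in `Δ𝐒`,
`τ = id` if `lam (g_i) = 1` and `τ = (i,i+1)` if `lam (g_i) = -1`. -/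
def tsig {G : Type} [Group G] (lam : G → ℤˣ) (S : SymCSG) {n : ℕ} (x : W G n)
    (i : Fin (n + 1)) : W G (n + 1) :=
  ((fun j => x.1 ((SimplexCategory.σ i).toOrderHom j)),
   (if lam (x.1 i) = 1 then 1 else Equiv.swap i.castSucc i.succ) *
     S.hact (SimplexCategory.σ i) x.2)

/-- `L_n(g) = (φ₀*(g), φ₁*(g), …, φ_n*(g); θ_g)`. -/
def Lfun {G : ℕ → Type} [∀ n, Group (G n)] (C : CSG G) (n : ℕ) (g : G n)
    (θ : Equiv.Perm (Fin (n + 1))) : W (G 0) n :=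
  (fun i => C.hact (SimplexCategory.const (mk 0) (mk n) i) g, θ)

/-- The permutations `θ_g` satisfy `θ_g ∘ g*(ψ) = ψ ∘ θ_{ψ*(g)}`. -/
theorem CSG.theta_compat {G : ℕ → Type} [∀ n, Group (G n)] (C : CSG G)
    (Θ : ∀ n, G n → Equiv.Perm (Fin (n + 1)))
    (hΘ : ∀ (n : ℕ) (g : G n) (i : Fin (n + 1)),
      C.vact g (SimplexCategory.const (SimplexCategory.mk 0) (SimplexCategory.mk n) i)
        = SimplexCategory.const (SimplexCategory.mk 0) (SimplexCategory.mk n) ((Θ n g)⁻¹ i))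
    {m n : ℕ} (g : G n) (ψ : SimplexCategory.mk m ⟶ SimplexCategory.mk n) (y : Fin (m + 1)) :
    Θ n g ((C.vact g ψ).toOrderHom y) = ψ.toOrderHom (Θ m (C.hact ψ g) y) := by
  have h := C.id2h ψ
    (SimplexCategory.const (SimplexCategory.mk 0) (SimplexCategory.mk m) (Θ m (C.hact ψ g) y)) g
  rw [SimplexCategory.const_comp, hΘ, hΘ, SimplexCategory.const_comp] at h
  have h' := congrArg (fun f => f.toOrderHom 0) h
  change (Θ n g)⁻¹ (ψ.toOrderHom (Θ m (C.hact ψ g) y)) =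
    (C.vact g ψ).toOrderHom ((Θ m (C.hact ψ g))⁻¹ (Θ m (C.hact ψ g) y)) at h'
  rw [Equiv.Perm.coe_inv (Θ m _), Equiv.symm_apply_apply] at h'
  rw [← h', Equiv.Perm.coe_inv, Equiv.apply_symm_apply]

/-- A monotone map which is a rearrangement of `γ⁻¹ ∘ ψ` must be `γ*(ψ)`. -/
theorem SymCSG.vact_unique (S : SymCSG) {m n : ℕ} (γ : Equiv.Perm (Fin (n + 1)))
    (ψ f : SimplexCategory.mk m ⟶ SimplexCategory.mk n) (π : Equiv.Perm (Fin (m + 1)))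
    (h : ∀ y : Fin (m + 1), γ (f.toOrderHom y) = ψ.toOrderHom (π y)) (y : Fin (m + 1)) :
    f.toOrderHom y = (S.vact γ ψ).toOrderHom y := by
  let F : Fin (m + 1) → Fin (n + 1) := fun x => γ⁻¹ (ψ.toOrderHom x)
  have h₁ : F ∘ π = f.toOrderHom := by
    funext x
    change γ⁻¹ (ψ.toOrderHom (π x)) = f.toOrderHom x
    rw [← h x, Equiv.Perm.coe_inv, Equiv.symm_apply_apply]
  have h₂ : F ∘ S.hact ψ γ = (S.vact γ ψ).toOrderHom := by
    funext x
    change γ⁻¹ (ψ.toOrderHom (S.hact ψ γ x)) = (S.vact γ ψ).toOrderHom x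
    rw [← S.compat, Equiv.Perm.coe_inv, Equiv.symm_apply_apply]
  have h₃ : F ∘ π = F ∘ S.hact ψ γ :=
    Tuple.unique_monotone (h₁ ▸ f.toOrderHom.monotone)
      (h₂ ▸ (S.vact γ ψ).toOrderHom.monotone)
  exact congrFun (h₁.symm.trans (h₃.trans h₂)) y

theorem predAbove_eq_predAbove {n : ℕ} {i : Fin (n + 1)} {a b : Fin (n + 2)}
    (h : i.predAbove a = i.predAbove b) :
    a = b ∨ (a = i.castSucc ∧ b = i.succ) ∨ (a = i.succ ∧ b = i.castSucc) := by
  simp only [Fin.predAbove, Fin.lt_def, Fin.ext_iff] at h ⊢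
  split_ifs at h <;> simp at h ⊢ <;> simp at * <;> omega

/-- A permutation preserving the fibers of `σ_i` is trivial or the transposition `(i, i+1)`. -/
theorem perm_eq_one_or_swap {n : ℕ} {i : Fin (n + 1)} {τ : Equiv.Perm (Fin (n + 2))}
    (h : ∀ a, i.predAbove (τ a) = i.predAbove a) :
    τ = 1 ∨ τ = Equiv.swap i.castSucc i.succ := by
  have hne : i.castSucc ≠ i.succ := (Fin.castSucc_lt_succ).ne
  have key := fun a => predAbove_eq_predAbove (h a)
  have hinj := τ.injective
  by_cases h₀ : τ i.castSucc = i.castSucc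
  · left
    ext1 a
    rcases key a with ha | ha | ha
    · exact ha
    · exact absurd (hinj (h₀.trans ha.1.symm)) (ha.2 ▸ hne)
    · exact absurd (h₀.symm.trans (ha.2 ▸ ha.1)) hne
  · right
    have h₁ : τ i.castSucc = i.succ := by grind
    have h₂ : τ i.succ = i.castSucc := by grind
    ext1 a
    by_cases ha₀ : a = i.castSucc
    · rw [ha₀, h₁, Equiv.swap_apply_left]
    by_cases ha₁ : a = i.succ
    · rw [ha₁, h₂, Equiv.swap_apply_right]
    rw [Equiv.swap_apply_of_ne_of_ne ha₀ ha₁]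
    grind

theorem perm_fin_two_eq_one_or_swap (τ : Equiv.Perm (Fin 2)) :
    τ = 1 ∨ τ = Equiv.swap 0 1 := by
  decide +revert

/-- The edge `[1] → [n+1]` with vertices `i` and `i + 1`, which `σ_i` collapses to the
vertex `i`. -/
theorem exists_edge_comp_sigma {n : ℕ} (i : Fin (n + 1)) :
    ∃ χ : mk 1 ⟶ mk (n + 1), χ.toOrderHom 0 = i.castSucc ∧ χ.toOrderHom 1 = i.succ ∧
      χ ≫ SimplexCategory.σ i =
        SimplexCategory.σ (0 : Fin 1) ≫ SimplexCategory.const (mk 0) (mk n) i := by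
  refine ⟨SimplexCategory.mkOfSucc i, rfl, rfl, ?_⟩
  ext x : 3
  fin_cases x
  · exact Fin.predAbove_castSucc_self i
  · exact Fin.predAbove_succ_self i

theorem stmt7 (G : ℕ → Type) [∀ n, Group (G n)] (C : CSG G) (S : SymCSG)
    -- `lam` is the canonical parity `λ₀ : G₀ → C₂` of `ΔG`:
    (lam : G 0 → ℤˣ)
    (hlam : ∀ g : G 0,
      (C.vact (C.hact (SimplexCategory.σ (0 : Fin 1)) g) (SimplexCategory.δ (0 : Fin 2))
          = SimplexCategory.δ (0 : Fin 2) → lam g = 1) ∧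
      (C.vact (C.hact (SimplexCategory.σ (0 : Fin 1)) g) (SimplexCategory.δ (0 : Fin 2))
          = SimplexCategory.δ (1 : Fin 2) → lam g = -1))
    -- `Θ n g` is the permutation `θ_g`, characterized by `g*(φ_i) = φ_{θ_g⁻¹(i)}`:
    (Θ : ∀ n, G n → Equiv.Perm (Fin (n + 1)))
    (hΘ : ∀ (n : ℕ) (g : G n) (i : Fin (n + 1)),
      C.vact g (SimplexCategory.const (mk 0) (mk n) i)
        = SimplexCategory.const (mk 0) (mk n) ((Θ n g)⁻¹ i)) :
    -- (i) `θ_{L_n(g)} = θ_g`, where `θ_{L_n(g)}` is computed in `Δλ₀≀Σ`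
    -- (an element `(g;γ)` of `Δλ₀≀Σ` acts on morphisms of `Δ` through `γ` via `Δ𝐒`):
    (∀ (n : ℕ) (g : G n) (θ' : Equiv.Perm (Fin (n + 1))),
      (∀ i : Fin (n + 1), S.vact (Θ n g) (SimplexCategory.const (mk 0) (mk n) i)
        = SimplexCategory.const (mk 0) (mk n) (θ'⁻¹ i)) →
      θ' = Θ n g) ∧
    -- (ii) `L_{n-1}(δ_i*(g)) = δ_i*(L_n(g))` for `n ≥ 1`:
    (∀ (n : ℕ) (g : G (n + 1)) (i : Fin (n + 2)),
      Lfun C n (C.hact (SimplexCategory.δ i) g) (Θ n (C.hact (SimplexCategory.δ i) g))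
        = tdel S (Lfun C (n + 1) g (Θ (n + 1) g)) i) ∧
    -- (iii) `L_{n+1}(σ_i*(g)) = σ_i*(L_n(g))`:
    (∀ (n : ℕ) (g : G n) (i : Fin (n + 1)),
      Lfun C (n + 1) (C.hact (SimplexCategory.σ i) g) (Θ (n + 1) (C.hact (SimplexCategory.σ i) g))
        = tsig lam S (Lfun C n g (Θ n g)) i) := by
  refine ⟨fun n g θ' h => ?_, fun n g i => ?_, fun n g i => ?_⟩
  · ext1 j
    have hc := S.compat (Θ n g) (SimplexCategory.const (mk 0) (mk n) (θ' j)) 0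
    rw [h] at hc
    change Θ n g (θ'⁻¹ (θ' j)) = θ' j at hc
    rw [Equiv.Perm.coe_inv, Equiv.symm_apply_apply] at hc
    exact hc.symm
  · have hc := C.theta_compat Θ hΘ g (SimplexCategory.δ i)
    refine Prod.ext ?_ ?_
    · funext j
      change C.hact _ (C.hact _ g) = C.hact _ g
      rw [← C.id1h, SimplexCategory.const_comp]
    · ext1 y
      change _ = S.hact (SimplexCategory.δ i) (Θ (n + 1) g) y
      have hv := S.vact_unique _ _ _ _ hc y
      have := hc y
      rw [hv, S.compat] at this
      exact (Fin.succAbove_right_injective (p := i) this).symm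
  · have hc := C.theta_compat Θ hΘ g (SimplexCategory.σ i)
    refine Prod.ext ?_ ?_
    · funext j
      change C.hact _ (C.hact _ g) = C.hact _ g
      rw [← C.id1h, SimplexCategory.const_comp]
    set π := Θ (n + 1) (C.hact (SimplexCategory.σ i) g) with hπ
    set ρ := S.hact (SimplexCategory.σ i) (Θ n g) with hρ
    set gi := C.hact (SimplexCategory.const (mk 0) (mk n) i) g
    change π = (if lam gi = 1 then 1 else Equiv.swap i.castSucc i.succ) * ρ
    have hσ : ∀ y, i.predAbove (π y) = i.predAbove (ρ y) := fun y => by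
      have hv := S.vact_unique _ _ _ _ hc y
      have := hc y
      rw [hv, S.compat] at this
      exact this.symm
    have hρlt : ρ⁻¹ i.castSucc < ρ⁻¹ i.succ := by
      by_contra hle
      have hv : (S.vact (Θ n g) (SimplexCategory.σ i)).toOrderHom (ρ⁻¹ i.succ) =
          (S.vact (Θ n g) (SimplexCategory.σ i)).toOrderHom (ρ⁻¹ i.castSucc) := by
        apply (Θ n g).injective
        rw [S.compat, S.compat, ← hρ, Equiv.Perm.coe_inv, Equiv.apply_symm_apply, Equiv.apply_symm_apply]
        exact (Fin.predAbove_succ_self i).trans (Fin.predAbove_castSucc_self i).symm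
      have hm := S.fiber_mono _ _ _ _ hv (not_lt.mp hle)
      rw [← hρ, Equiv.Perm.coe_inv, Equiv.apply_symm_apply, Equiv.apply_symm_apply] at hm
      exact absurd hm (not_le.mpr Fin.castSucc_lt_succ)
    have hlamπ : (lam gi = 1 ∧ π⁻¹ i.castSucc ≤ π⁻¹ i.succ) ∨
        (lam gi = -1 ∧ π⁻¹ i.succ ≤ π⁻¹ i.castSucc) := by
      obtain ⟨χ, hχ₀, hχ₁, hχ⟩ := exists_edge_comp_sigma i
      have hh : C.hact χ (C.hact (SimplexCategory.σ i) g) =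
          C.hact (SimplexCategory.σ (0 : Fin 1)) gi := by
        rw [← C.id1h, hχ, C.id1h]
      have hπχ := C.theta_compat Θ hΘ (C.hact (SimplexCategory.σ i) g) χ
      rw [hh, ← hπ] at hπχ
      have hmono := (C.vact (C.hact (SimplexCategory.σ i) g) χ).toOrderHom.monotone
        (Fin.zero_le 1 : (0 : Fin 2) ≤ 1)
      have hδ := hΘ 1 (C.hact (SimplexCategory.σ (0 : Fin 1)) gi) 1
      have hδ₀ : SimplexCategory.δ (0 : Fin 2) = SimplexCategory.const (mk 0) (mk 1) 1 :=
        SimplexCategory.δ_zero_eq_const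
      have hδ₁ : SimplexCategory.δ (1 : Fin 2) = SimplexCategory.const (mk 0) (mk 1) 0 :=
        SimplexCategory.δ_one_eq_const
      have hl := hlam gi
      have e₀ := hπχ 0
      have e₁ := hπχ 1
      rcases perm_fin_two_eq_one_or_swap
        (Θ 1 (C.hact (SimplexCategory.σ (0 : Fin 1)) gi)) with ht | ht
      · left
        rw [ht] at hδ e₀ e₁
        refine ⟨hl.1 (hδ₀ ▸ hδ), ?_⟩
        rw [← hχ₀, ← hχ₁]
        erw [← e₀, ← e₁]
        simpa using hmono
      · right
        rw [ht] at hδ e₀ e₁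
        refine ⟨hl.2 (by rw [hδ₀, hδ₁]; exact hδ), ?_⟩
        rw [← hχ₀, ← hχ₁]
        erw [← e₀, ← e₁]
        simpa using hmono
    have hτ : ∀ a, i.predAbove ((π * ρ⁻¹) a) = i.predAbove a := fun a => by
      rw [Equiv.Perm.mul_apply, hσ, Equiv.Perm.coe_inv, Equiv.apply_symm_apply]
    rcases perm_eq_one_or_swap hτ with h | h <;> rw [mul_inv_eq_iff_eq_mul] at h
    · rw [one_mul] at h
      rcases hlamπ with ⟨hl, -⟩ | ⟨-, hle⟩
      · rw [if_pos hl, one_mul, h]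
      · rw [h] at hle
        exact absurd hρlt (not_lt.mpr hle)
    · rcases hlamπ with ⟨-, hle⟩ | ⟨hl, -⟩
      · rw [h, mul_inv_rev, Equiv.swap_inv, Equiv.Perm.mul_apply, Equiv.Perm.mul_apply,
          Equiv.swap_apply_left, Equiv.swap_apply_right] at hle
        exact absurd hρlt (not_lt.mpr hle)
      · rw [if_neg (by rw [hl]; decide), h]
end

section
/- Let {G_n}_{n≥0} be a sequence of groups with operations ψ*(g) ∈ G_m and g*(ψ) ∈ Δ([m],[n]) (for ψ ∈ Δ([m],[n]) and g ∈ G_n) satisfying the six crossed-simplicial-group identities (1.h), (2.h), (3.h), (1.v), (2.v), (3.v). Then the composition law on the sets Hom([m],[n]) := Δ([m],[n]) × G_m defined by (φ,g)∘(ψ,h) := (φ∘(g*(ψ)), h·(ψ*(g))) is associative and unital with identities (id, e); hence there is a category ΔG with objects the sets [n], these hom-sets, and this composition, in which every morphism factors uniquely as an order-preserving map composed with a group element, and which contains Δ as a wide subcategory via φ ↦ (φ,e). -/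
/-!
STATEMENT 14: from a sequence of groups with operations satisfying the six
crossed-simplicial-group identities, the composition law
`(φ,g)∘(ψ,h) := (φ∘(g*(ψ)), h·(ψ*(g)))` on `Hom([m],[n]) := Δ([m],[n]) × G_m` is
associative and unital; hence there is a category `ΔG` in which every morphism factors
uniquely as an order-preserving map composed with a group element, containing `Δ` as a
wide subcategory via `φ ↦ (φ,e)`.
-/

open CategoryTheory SimplexCategory

/-- Hom-sets of the category `ΔG`: `Hom([k],[n]) := Δ([k],[n]) × G_k`. -/
abbrev CH (G : ℕ → Type) (k n : ℕ) : Type := (mk k ⟶ mk n) × G k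

/-- The composition law `(φ,g)∘(ψ,h) := (φ∘(g*(ψ)), h·(ψ*(g)))`;
here `f = (φ,g) : [m] → [n]` is the second morphism, `u = (ψ,h) : [k] → [m]` the first. -/
def ccomp {G : ℕ → Type} [∀ n, Group (G n)]
    (hact : ∀ {m n : ℕ}, (mk m ⟶ mk n) → G n → G m)
    (vact : ∀ {m n : ℕ}, G n → (mk m ⟶ mk n) → (mk m ⟶ mk n))
    {k m n : ℕ} (f : CH G m n) (u : CH G k m) : CH G k n :=
  (vact f.2 u.1 ≫ f.1, u.2 * hact u.1 f.2)

theorem stmt14 (G : ℕ → Type) [∀ n, Group (G n)]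
    (hact : ∀ {m n : ℕ}, (mk m ⟶ mk n) → G n → G m)
    (vact : ∀ {m n : ℕ}, G n → (mk m ⟶ mk n) → (mk m ⟶ mk n))
    (h1h : ∀ {k m n : ℕ} (ψ : mk m ⟶ mk n) (χ : mk k ⟶ mk m) (g : G n),
      hact (χ ≫ ψ) g = hact χ (hact ψ g))
    (h3h₁ : ∀ {n : ℕ} (g : G n), hact (𝟙 (mk n)) g = g)
    (h3h₂ : ∀ {m n : ℕ} (ψ : mk m ⟶ mk n), hact ψ (1 : G n) = 1)
    (h1v : ∀ {m n : ℕ} (g h : G n) (ψ : mk m ⟶ mk n), vact (g * h) ψ = vact h (vact g ψ))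
    (h3v₁ : ∀ {m n : ℕ} (ψ : mk m ⟶ mk n), vact (1 : G n) ψ = ψ)
    (h3v₂ : ∀ {n : ℕ} (g : G n), vact g (𝟙 (mk n)) = 𝟙 (mk n))
    (h2h : ∀ {k m n : ℕ} (ψ : mk m ⟶ mk n) (χ : mk k ⟶ mk m) (g : G n),
      vact g (χ ≫ ψ) = vact (hact ψ g) χ ≫ vact g ψ)
    (h2v : ∀ {m n : ℕ} (ψ : mk m ⟶ mk n) (g h : G n),
      hact ψ (g * h) = hact ψ g * hact (vact g ψ) h) :
    -- associativity of the composition law: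
    (∀ (j k m n : ℕ) (f : CH G m n) (u : CH G k m) (v : CH G j k),
      ccomp hact vact (ccomp hact vact f u) v = ccomp hact vact f (ccomp hact vact u v)) ∧
    -- unitality, with identities `(id, e)`:
    (∀ (k n : ℕ) (f : CH G k n), ccomp hact vact f (𝟙 (mk k), (1 : G k)) = f) ∧
    (∀ (k n : ℕ) (f : CH G k n), ccomp hact vact (𝟙 (mk n), (1 : G n)) f = f) ∧
    -- unique factorization as an order-preserving map composed with a group element:
    (∀ (k n : ℕ) (f : CH G k n), ∃! p : (mk k ⟶ mk n) × G k,
      f = ccomp hact vact (p.1, (1 : G k)) (𝟙 (mk k), p.2)) ∧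
    -- `Δ` is a wide subcategory via `φ ↦ (φ, e)`:
    (∀ (k m n : ℕ) (φ : mk m ⟶ mk n) (ψ : mk k ⟶ mk m),
      ccomp hact vact (φ, (1 : G m)) (ψ, (1 : G k)) = (ψ ≫ φ, (1 : G k))) ∧
    (∀ (k n : ℕ), Function.Injective (fun φ : mk k ⟶ mk n => ((φ, 1) : CH G k n))) := by
  refine ⟨?_, ?_, ?_, ?_, ?_, ?_⟩
  · rintro j k m n ⟨φ, g⟩ ⟨ψ, h⟩ ⟨χ, l⟩
    simp only [ccomp, h1v, h2h, h2v, h1h, mul_assoc, Category.assoc]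
  · rintro k n ⟨φ, g⟩
    simp only [ccomp, h3v₂, h3h₁, Category.id_comp, one_mul]
  · rintro k n ⟨φ, g⟩
    simp only [ccomp, h3v₁, h3h₂, Category.comp_id, mul_one]
  · rintro k n ⟨φ, g⟩
    simp only [ccomp, h3v₂, h3h₁, Category.id_comp, mul_one]
    exact ⟨(φ, g), rfl, fun _ hp => hp.symm⟩
  · intro k m n φ ψ
    simp only [ccomp, h3v₁, h3h₂, mul_one]
  · intro k n φ ψ h
    exact congrArg Prod.fst h
end
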